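/- Under the conditions λₙ = c₁ n^{−a}, κₙ = c₂ n^{−b}, c₂ > 0, 0 ≤ a ≤ b < 1/2, τ₀ ∈ (−1,1), and Tₙ = (3/2)√n·Δ + Rₙ with Δ ∈ (−1−τ₀, 1−τ₀)\{0} fixed and Rₙ bounded (H₁ true), the Bayes factor BF₀₁(n) defined as in Theorem 1 tends to 0 as n → ∞. -/

import Mathlib

open Real MeasureTheory Filter Topology

/-- standard normal pdf -/
noncomputable def phi (x : ℝ) : ℝ := (Real.sqrt (2 * Real.pi))⁻¹ * Real.exp (-x ^ 2 / 2)

/-- standard normal cdf -/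
noncomputable def Phi (x : ℝ) : ℝ := ∫ t in Set.Iic x, phi t


lemma phi_pos' (x : ℝ) : 0 < phi x := by
  unfold phi; positivity

lemma phi_integrable : Integrable phi := by
  have h := (integrable_exp_neg_mul_sq (b := 1 / 2) (by norm_num)).const_mul
    (Real.sqrt (2 * Real.pi))⁻¹
  refine h.congr (ae_of_all _ fun x => ?_)
  simp only [phi]
  congr 2
  ring

lemma Phi_nonneg' (x : ℝ) : 0 ≤ Phi x :=
  integral_nonneg fun t => (phi_pos' t).le

lemma Phi_le' (x : ℝ) : Phi x ≤ ∫ t, phi t :=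
  setIntegral_le_integral phi_integrable (ae_of_all _ fun t => (phi_pos' t).le)

lemma Phi_diff_abs (x y : ℝ) : |Phi y - Phi x| ≤ ∫ t, phi t := by
  rw [abs_le]
  have h1 := Phi_nonneg' x
  have h2 := Phi_nonneg' y
  have h3 := Phi_le' x
  have h4 := Phi_le' y
  constructor <;> linarith

lemma Phi_diff_lower (x y K : ℝ) (hxy : x ≤ y) (hx : |x| ≤ K) (hy : |y| ≤ K) :
    (y - x) * phi K ≤ Phi y - Phi x := by
  have h : Phi y - Phi x = ∫ t in x..y, phi t :=
    intervalIntegral.integral_Iic_sub_Iic phi_integrable.integrableOn phi_integrable.integrableOn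
  rw [h]
  have h2 : ∫ t in x..y, phi K ≤ ∫ t in x..y, phi t := by
    apply intervalIntegral.integral_mono_on hxy (by simp) phi_integrable.intervalIntegrable
    intro t ht
    have ht' : |t| ≤ K := by
      rw [abs_le] at *
      exact ⟨by linarith [ht.1], by linarith [ht.2]⟩
    have : t ^ 2 ≤ K ^ 2 := by
      rw [← sq_abs t]
      exact pow_le_pow_left₀ (abs_nonneg t) ht' 2
    unfold phi
    gcongr
  simpa using h2

lemma aux_bound (n k l A τ₀ c₁ c₂ D m s : ℝ) (hn : 1 ≤ n) (hτ : τ₀ ∈ Set.Ioo (-1 : ℝ) 1)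
    (hk : 0 < k) (hkc : k ≤ c₂) (hl : |l| ≤ |c₁|) (hD : D = 9 * n / 4 + 1 / k ^ 2)
    (hm : m = A / D) (hs : s = D ^ (-(1 : ℝ) / 2)) :
    |Real.sqrt (9 * n * k ^ 2 / 4 + 1) *
          Real.exp ((1 / 2) * (l ^ 2 / k ^ 2 - m ^ 2 / s ^ 2)) *
          ((Phi ((1 - τ₀ - m) / s) - Phi ((-1 - τ₀ - m) / s)) /
            (Phi ((1 - τ₀ - l) / k) - Phi ((-1 - τ₀ - l) / k)))| ≤
      ((9 * c₂ ^ 2 / 4 + 1) * (∫ t, phi t) * (c₂ / 2 * Real.sqrt (2 * Real.pi))) *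
      (n * Real.exp (n * ((1 / 2) * (c₁ ^ 2 + (2 + |c₁|) ^ 2) * (1 / (k ^ 2 * n)) -
        (1 / 2) * ((A / n) ^ 2 / (D / n))))) := by
  have hc₂ : 0 < c₂ := hk.trans_le hkc
  have hn0 : 0 < n := by linarith
  have hDpos : 0 < D := by rw [hD]; positivity
  have hs2 : s ^ 2 = D⁻¹ := by
    rw [hs, ← Real.rpow_natCast, ← Real.rpow_mul hDpos.le]
    norm_num
    exact Real.rpow_neg_one D
  have hms : m ^ 2 / s ^ 2 = A ^ 2 / D := by
    rw [hs2, hm]; field_simp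
  obtain ⟨hτ1, hτ2⟩ := hτ
  obtain ⟨hl1, hl2⟩ := abs_le.1 hl
  have hden := Phi_diff_lower ((-1 - τ₀ - l) / k) ((1 - τ₀ - l) / k) ((2 + |c₁|) / k)
    (by gcongr; norm_num)
    (by rw [abs_div, abs_of_pos hk]; gcongr; rw [abs_le]; constructor <;> linarith)
    (by rw [abs_div, abs_of_pos hk]; gcongr; rw [abs_le]; constructor <;> linarith)
  set P := Phi ((1 - τ₀ - l) / k) - Phi ((-1 - τ₀ - l) / k) with hP
  have hnum := Phi_diff_abs ((-1 - τ₀ - m) / s) ((1 - τ₀ - m) / s)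
  set Q := Phi ((1 - τ₀ - m) / s) - Phi ((-1 - τ₀ - m) / s) with hQ
  set E := Real.exp (-((2 + |c₁|) / k) ^ 2 / 2) with hE
  have hEpos : 0 < E := Real.exp_pos _
  set S := Real.sqrt (2 * Real.pi) with hS
  have hSpos : 0 < S := by positivity
  have hden2 : 2 / c₂ * (S⁻¹ * E) ≤ P := by
    refine le_trans ?_ hden
    have h1 : (1 - τ₀ - l) / k - (-1 - τ₀ - l) / k = 2 / k := by field_simp; ring
    rw [h1]
    unfold phi
    gcongr
  have hLpos : 0 < 2 / c₂ * (S⁻¹ * E) := by positivity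
  have hPpos : 0 < P := hLpos.trans_le hden2
  have hI : 0 ≤ ∫ t, phi t := integral_nonneg fun t => (phi_pos' t).le
  have hsq : Real.sqrt (9 * n * k ^ 2 / 4 + 1) ≤ (9 * c₂ ^ 2 / 4 + 1) * n := by
    have hk2 : k ^ 2 ≤ c₂ ^ 2 := pow_le_pow_left₀ hk.le hkc 2
    have h2 : 1 ≤ (9 * c₂ ^ 2 / 4 + 1) * n := by nlinarith [sq_nonneg c₂]
    have h3 : 9 * n * k ^ 2 / 4 + 1 ≤ (9 * c₂ ^ 2 / 4 + 1) * n := by nlinarith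
    rw [Real.sqrt_le_left (by linarith)]
    nlinarith
  have hl2' : l ^ 2 ≤ c₁ ^ 2 := sq_le_sq.2 hl
  rw [abs_mul, abs_mul, abs_div, abs_of_pos hPpos, abs_of_pos (Real.exp_pos _),
    abs_of_nonneg (Real.sqrt_nonneg _), hms]
  have hexp : Real.exp ((1 / 2) * (l ^ 2 / k ^ 2 - A ^ 2 / D)) ≤
      Real.exp ((1 / 2) * (c₁ ^ 2 / k ^ 2 - A ^ 2 / D)) := by
    gcongr
  calc _ ≤ ((9 * c₂ ^ 2 / 4 + 1) * n) * Real.exp ((1 / 2) * (c₁ ^ 2 / k ^ 2 - A ^ 2 / D)) *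
        ((∫ t, phi t) / (2 / c₂ * (S⁻¹ * E))) := by gcongr
    _ = ((9 * c₂ ^ 2 / 4 + 1) * (∫ t, phi t) * (c₂ / 2 * S)) *
      (n * (Real.exp ((1 / 2) * (c₁ ^ 2 / k ^ 2 - A ^ 2 / D)) / E)) := by
        field_simp
    _ = _ := by
        rw [hE, ← Real.exp_sub]
        congr 3
        field_simp
        ring

theorem stmt_17 (τ₀ Δ : ℝ) (hτ : τ₀ ∈ Set.Ioo (-1 : ℝ) 1)
    (hΔ₁ : -1 - τ₀ < Δ) (hΔ₂ : Δ < 1 - τ₀) (hΔ : Δ ≠ 0)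
    (R : ℕ → ℝ) (M : ℝ) (hR : ∀ n, |R n| ≤ M)
    (T : ℕ → ℝ) (hT : ∀ n : ℕ, T n = (3 / 2) * Real.sqrt n * Δ + R n)
    (c₁ c₂ a b : ℝ) (hc₂ : 0 < c₂) (ha : 0 ≤ a) (hab : a ≤ b) (hb : b < 1 / 2)
    (lam kap μ σ BF : ℕ → ℝ)
    (hlam : ∀ n : ℕ, lam n = c₁ * (n : ℝ) ^ (-a))
    (hkap : ∀ n : ℕ, kap n = c₂ * (n : ℝ) ^ (-b))
    (hμ : ∀ n : ℕ, μ n = ((3 * Real.sqrt n / 2) * T n + lam n / kap n ^ 2) /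
        (9 * (n : ℝ) / 4 + 1 / kap n ^ 2))
    (hσ : ∀ n : ℕ, σ n = (9 * (n : ℝ) / 4 + 1 / kap n ^ 2) ^ (-(1 : ℝ) / 2))
    (hBF : ∀ n : ℕ, BF n =
        Real.sqrt (9 * (n : ℝ) * kap n ^ 2 / 4 + 1) *
          Real.exp ((1 / 2) * (lam n ^ 2 / kap n ^ 2 - μ n ^ 2 / σ n ^ 2)) *
          ((Phi ((1 - τ₀ - μ n) / σ n) - Phi ((-1 - τ₀ - μ n) / σ n)) /
            (Phi ((1 - τ₀ - lam n) / kap n) - Phi ((-1 - τ₀ - lam n) / kap n)))) :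
    Tendsto BF atTop (nhds 0) := by
  have hkey : ∀ᶠ n : ℕ in atTop, 1 ≤ (n : ℝ) := by
    filter_upwards [eventually_ge_atTop 1] with n hn
    exact_mod_cast hn
  have hnat : Tendsto (fun n : ℕ => (n : ℝ)) atTop atTop := tendsto_natCast_atTop_atTop
  have hb0 : 0 ≤ b := ha.trans hab
  have hkpos : ∀ n : ℕ, 1 ≤ (n : ℝ) → 0 < kap n := fun n hn => by
    rw [hkap]; have : (0 : ℝ) < n := by linarith
    positivity
  have hkc : ∀ n : ℕ, 1 ≤ (n : ℝ) → kap n ≤ c₂ := fun n hn => by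
    rw [hkap]
    exact mul_le_of_le_one_right hc₂.le (Real.rpow_le_one_of_one_le_of_nonpos hn (by linarith))
  have hlc : ∀ n : ℕ, 1 ≤ (n : ℝ) → |lam n| ≤ |c₁| := fun n hn => by
    have h0 : (0 : ℝ) ≤ n := by linarith
    rw [hlam, abs_mul, abs_of_nonneg (Real.rpow_nonneg h0 _)]
    exact mul_le_of_le_one_right (abs_nonneg _)
      (Real.rpow_le_one_of_one_le_of_nonpos hn (by linarith))
  -- the small quantity
  have hq : Tendsto (fun n : ℕ => 1 / (kap n ^ 2 * (n : ℝ))) atTop (nhds 0) := by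
    have h1 : Tendsto (fun n : ℕ => (c₂ ^ 2)⁻¹ * (n : ℝ) ^ (-(1 - 2 * b))) atTop
        (nhds ((c₂ ^ 2)⁻¹ * 0)) :=
      ((tendsto_rpow_neg_atTop (by linarith)).comp hnat).const_mul _
    rw [mul_zero] at h1
    refine h1.congr' ?_
    filter_upwards [hkey] with n hn
    have h0 : (0 : ℝ) < n := by linarith
    rw [hkap, mul_pow, ← Real.rpow_natCast ((n : ℝ) ^ (-b)), ← Real.rpow_mul h0.le, mul_assoc,
      ← Real.rpow_add_one h0.ne', one_div, mul_inv, ← Real.rpow_neg h0.le]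
    congr 2
    push_cast
    ring
  have hlq : Tendsto (fun n : ℕ => lam n * (1 / (kap n ^ 2 * (n : ℝ)))) atTop (nhds 0) := by
    have h1 := hq.const_mul |c₁|
    rw [mul_zero] at h1
    refine squeeze_zero_norm' ?_ h1
    filter_upwards [hkey] with n hn
    have h2 := hlc n hn
    have h3 := hkpos n hn
    rw [Real.norm_eq_abs, abs_mul, abs_of_nonneg (a := 1 / (kap n ^ 2 * (n : ℝ))) (by positivity)]
    gcongr
  have hsqrt : Tendsto (fun n : ℕ => Real.sqrt n) atTop atTop := Real.tendsto_sqrt_atTop.comp hnat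
  have hRs : Tendsto (fun n : ℕ => R n / Real.sqrt n) atTop (nhds 0) := by
    have h1 : Tendsto (fun n : ℕ => M / Real.sqrt n) atTop (nhds 0) := hsqrt.const_div_atTop M
    refine squeeze_zero_norm (fun n => ?_) h1
    rw [Real.norm_eq_abs, abs_div, abs_of_nonneg (Real.sqrt_nonneg _)]
    gcongr
    exact hR n
  set A : ℕ → ℝ := fun n => (3 * Real.sqrt n / 2) * T n + lam n / kap n ^ 2 with hA
  set D : ℕ → ℝ := fun n => 9 * (n : ℝ) / 4 + 1 / kap n ^ 2 with hD
  have hAn : Tendsto (fun n : ℕ => A n / n) atTop (nhds (9 / 4 * Δ)) := by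
    have h1 := ((hRs.const_mul (3 / 2)).const_add (9 / 4 * Δ)).add hlq
    simp only [mul_zero, add_zero] at h1
    refine h1.congr' ?_
    filter_upwards [hkey] with n hn
    have h0 : (0 : ℝ) < n := by linarith
    have h3 := hkpos n hn
    have h4 : Real.sqrt n ^ 2 = n := Real.sq_sqrt h0.le
    have h5 : 0 < Real.sqrt n := Real.sqrt_pos.2 h0
    simp only [hA, hT]
    have h6 : R n / Real.sqrt n = Real.sqrt n * R n / n := by
      rw [div_eq_div_iff h5.ne' h0.ne']
      nth_rewrite 1 [← h4]
      ring
    have h7 : 3 * Real.sqrt n / 2 * (3 / 2 * Real.sqrt n * Δ + R n)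
        = 9 / 4 * Δ * n + 3 / 2 * (Real.sqrt n * R n) := by
      linear_combination (9 / 4 * Δ) * h4
    rw [h6, h7]
    field_simp
  have hDn : Tendsto (fun n : ℕ => D n / n) atTop (nhds (9 / 4)) := by
    have h1 := hq.const_add (9 / 4)
    simp only [add_zero] at h1
    refine h1.congr' ?_
    filter_upwards [hkey] with n hn
    have h0 : (0 : ℝ) < n := by linarith
    have h3 := hkpos n hn
    simp only [hD]
    field_simp
  have he : Tendsto (fun n : ℕ => (1 / 2) * (c₁ ^ 2 + (2 + |c₁|) ^ 2) * (1 / (kap n ^ 2 * n)) -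
        (1 / 2) * ((A n / n) ^ 2 / (D n / n))) atTop (nhds (-(9 / 8 * Δ ^ 2))) := by
    have h1 := (hq.const_mul ((1 / 2) * (c₁ ^ 2 + (2 + |c₁|) ^ 2))).sub
      (((hAn.pow 2).div hDn (by norm_num)).const_mul (1 / 2))
    have h2 : -(9 / 8 * Δ ^ 2) = 1 / 2 * (c₁ ^ 2 + (2 + |c₁|) ^ 2) * 0 -
        1 / 2 * ((9 / 4 * Δ) ^ 2 / (9 / 4)) := by ring
    rw [h2]
    exact h1
  have hΔ2 : 0 < Δ ^ 2 := by positivity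
  have hev := he.eventually_lt_const (show -(9 / 8 * Δ ^ 2) < -Δ ^ 2 by linarith)
  have hlim : Tendsto (fun n : ℕ =>
      ((9 * c₂ ^ 2 / 4 + 1) * (∫ t, phi t) * (c₂ / 2 * Real.sqrt (2 * Real.pi))) *
      ((n : ℝ) * Real.exp (-Δ ^ 2 * n))) atTop (nhds 0) := by
    have h1 := (Real.tendsto_pow_mul_exp_neg_atTop_nhds_zero 1).comp
      (hnat.const_mul_atTop hΔ2)
    have h2 := h1.const_mul (((9 * c₂ ^ 2 / 4 + 1) * (∫ t, phi t) *
      (c₂ / 2 * Real.sqrt (2 * Real.pi))) * (Δ ^ 2)⁻¹)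
    rw [mul_zero] at h2
    refine h2.congr fun n => ?_
    simp only [Function.comp, pow_one, neg_mul]
    field_simp
  refine squeeze_zero_norm' ?_ hlim
  filter_upwards [hkey, hev] with n hn hen
  have h0 : (0 : ℝ) < n := by linarith
  have hI : 0 ≤ ∫ t, phi t := integral_nonneg fun t => (phi_pos' t).le
  rw [Real.norm_eq_abs, hBF]
  refine (aux_bound n (kap n) (lam n) (A n) τ₀ c₁ c₂ (D n) (μ n) (σ n) hn hτ (hkpos n hn)
    (hkc n hn) (hlc n hn) rfl (hμ n) (hσ n)).trans ?_
  have : (n : ℝ) * ((1 / 2) * (c₁ ^ 2 + (2 + |c₁|) ^ 2) * (1 / (kap n ^ 2 * n)) -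
        (1 / 2) * ((A n / n) ^ 2 / (D n / n))) ≤ -Δ ^ 2 * n := by
    rw [mul_comm]
    exact mul_le_mul_of_nonneg_right hen.le h0.le
  gcongr
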